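/- For all integers r, s with r ≥ 2, s ≥ 2, and r·s ≥ 6, the asymmetric index of the grid graph satisfies ai(P_r □ P_s) = 1. -/

import Mathlib

/-- A simple graph is *asymmetric* if its only automorphism is the identity. -/
def SimpleGraph.IsAsymmetric {V : Type*} (G : SimpleGraph V) : Prop :=
  ∀ f : G ≃g G, ∀ v : V, f v = v

/-- The *asymmetric index* `ai(G)`: the minimum, over all asymmetric graphs `G'` on the
same vertex set, of the number of edges in which `G` and `G'` differ (edges removed plus
edges added); `⊤` (infinity) if no asymmetric graph on the vertex set exists. -/
noncomputable def SimpleGraph.asymIndex {V : Type*} (G : SimpleGraph V) : ℕ∞ :=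
  sInf {n : ℕ∞ | ∃ G' : SimpleGraph V, G'.IsAsymmetric ∧
    n = (symmDiff G.edgeSet G'.edgeSet).encard}

namespace SimpleGraph

section General

variable {V W : Type*}

/-- The asymmetric index does not increase along a graph isomorphism. -/
theorem Iso.asymIndex_le {G : SimpleGraph V} {H : SimpleGraph W} (φ : G ≃g H) :
    H.asymIndex ≤ G.asymIndex := by
  refine le_sInf ?_
  rintro _ ⟨G', hG', rfl⟩
  let ψ : G' ≃g G'.map φ.toEquiv.toEmbedding := Iso.map φ.toEquiv G'
  refine sInf_le ⟨G'.map φ.toEquiv.toEmbedding, fun f w => ?_, ?_⟩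
  · have h := hG' ((ψ.trans f).trans ψ.symm) (ψ.symm w)
    simpa using h
  · have hH : H = G.map φ.toEquiv.toEmbedding := by
      ext u v
      rw [← φ.apply_symm_apply u, ← φ.apply_symm_apply v, φ.map_adj_iff]
      exact (map_adj_apply (f := φ.toEquiv.toEmbedding)).symm
    have hE : H.edgeSet = Set.image φ.toEquiv.toEmbedding.sym2Map G.edgeSet := by
      conv_lhs => rw [hH]
      exact edgeSet_map ..
    rw [hE, edgeSet_map,
      ← Set.image_symmDiff (Function.Embedding.injective _),
      (Function.Embedding.injective _).encard_image]

/-- A graph that differs from an asymmetric graph in at most one pair has asymmetric index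
at most one. -/
theorem asymIndex_le_one {G G' : SimpleGraph V} (hG' : G'.IsAsymmetric) (a b : V)
    (h : ∀ u v, s(u, v) ≠ s(a, b) → (G.Adj u v ↔ G'.Adj u v)) : G.asymIndex ≤ 1 := by
  have hle : G.asymIndex ≤ (symmDiff G.edgeSet G'.edgeSet).encard := sInf_le ⟨G', hG', rfl⟩
  refine hle.trans ?_
  rw [← Set.encard_singleton s(a, b)]
  refine Set.encard_le_encard fun e => ?_
  induction e with | _ u v
  intro he
  by_contra hne
  have := h u v hne
  simp only [Set.mem_symmDiff, mem_edgeSet] at he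
  tauto

/-- A graph that is not asymmetric has positive asymmetric index. -/
theorem one_le_asymIndex {G : SimpleGraph V} (hG : ¬ G.IsAsymmetric) : 1 ≤ G.asymIndex := by
  refine le_sInf ?_
  rintro _ ⟨H, hH, rfl⟩
  rw [Set.one_le_encard_iff_nonempty, Set.nonempty_iff_ne_empty]
  intro h
  rw [← Set.bot_eq_empty, symmDiff_eq_bot, edgeSet_inj] at h
  subst h
  exact hG hH

/-- If `Q` is preserved by the injective map `f` and `w` is the only point satisfying `Q` that is
not yet known to be fixed, then `w` is fixed. -/
theorem fixed_of_invariant {f : V → V} (hf : Function.Injective f) (Q : V → Prop)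
    (hQ : ∀ x, Q x → Q (f x)) (w : V) (hw : Q w) (h : ∀ x, Q x → x ≠ w → f x = x) :
    f w = w := by
  by_contra hne
  exact hne (hf (h _ (hQ w hw) hne))

theorem Iso.adj_apply_of_fixed {G : SimpleGraph V} (f : G ≃g G) {v : V} (hv : f v = v) (x : V)
    (hx : G.Adj v x) : G.Adj v (f x) := by
  have := f.map_adj_iff.2 hx
  rwa [hv] at this

end General

theorem not_isAsymmetric_grid {r s : ℕ} (hr : 2 ≤ r) (hs : 2 ≤ s) :
    ¬ ((pathGraph r).boxProd (pathGraph s)).IsAsymmetric := by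
  intro h
  let f : (pathGraph r).boxProd (pathGraph s) ≃g (pathGraph r).boxProd (pathGraph s) :=
    { toEquiv := Equiv.prodCongr Fin.revPerm (Equiv.refl _)
      map_rel_iff' := by
        rintro ⟨a, b⟩ ⟨c, d⟩
        simp only [boxProd_adj, pathGraph_adj, Equiv.prodCongr_apply, Prod.map, Fin.revPerm_apply,
          Fin.val_rev, Equiv.refl_apply, Fin.ext_iff]
        omega }
  have h0 := congrArg (fun v => v.1.val) (h f (⟨0, by omega⟩, ⟨0, by omega⟩))
  simp [f, Fin.val_rev] at h0
  omega

/-- The `3 × 2` grid with the diagonal from `(0, 0)` to `(1, 1)` added. -/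
def gridThreeTwoDiagonal : SimpleGraph (Fin 3 × Fin 2) :=
  fromRel fun u v => u.1.val + 1 = v.1.val ∧ u.2 = v.2 ∨ u.2.val + 1 = v.2.val ∧ u.1 = v.1 ∨
    u = (0, 0) ∧ v = (1, 1)

instance : DecidableRel gridThreeTwoDiagonal.Adj :=
  inferInstanceAs (DecidableRel (fromRel _).Adj)

theorem isAsymmetric_gridThreeTwoDiagonal : gridThreeTwoDiagonal.IsAsymmetric := by
  intro f
  have hinj := f.injective
  have hdeg : ∀ x, gridThreeTwoDiagonal.degree (f x) = gridThreeTwoDiagonal.degree x :=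
    fun x => f.degree_eq x
  have h11 : f (1, 1) = (1, 1) := by
    refine fixed_of_invariant hinj (fun x => gridThreeTwoDiagonal.degree x = 4)
      (fun x hx => (hdeg x).trans hx) _ (by decide) fun x hx hne => absurd hne ?_
    revert x
    decide
  have h20 : f (2, 0) = (2, 0) := by
    refine fixed_of_invariant hinj
      (fun x => gridThreeTwoDiagonal.degree x = 2 ∧ ¬ gridThreeTwoDiagonal.Adj (1, 1) x)
      (fun x hx => ⟨(hdeg x).trans hx.1, fun h => hx.2 ?_⟩) _ (by decide)
      fun x hx hne => absurd hne ?_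
    · rwa [← h11, f.map_adj_iff] at h
    · revert x
      decide
  have h21 : f (2, 1) = (2, 1) := by
    refine fixed_of_invariant hinj
      (fun x => gridThreeTwoDiagonal.degree x = 2 ∧ gridThreeTwoDiagonal.Adj (2, 0) x)
      (fun x hx => ⟨(hdeg x).trans hx.1, f.adj_apply_of_fixed h20 x hx.2⟩) _ (by decide)
      fun x hx hne => absurd hne ?_
    revert x
    decide
  have h10 : f (1, 0) = (1, 0) := by
    refine fixed_of_invariant hinj
      (fun x => gridThreeTwoDiagonal.degree x = 3 ∧ gridThreeTwoDiagonal.Adj (2, 0) x)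
      (fun x hx => ⟨(hdeg x).trans hx.1, f.adj_apply_of_fixed h20 x hx.2⟩) _ (by decide)
      fun x hx hne => absurd hne ?_
    revert x
    decide
  have h00 : f (0, 0) = (0, 0) := by
    refine fixed_of_invariant hinj (fun x => gridThreeTwoDiagonal.degree x = 3)
      (fun x hx => (hdeg x).trans hx) _ (by decide) fun x hx hne => ?_
    obtain rfl : x = (1, 0) := by
      revert x
      decide
    exact h10
  have h01 : f (0, 1) = (0, 1) := by
    refine fixed_of_invariant hinj (fun _ => True) (fun _ h => h) _ trivial ?_
    rintro ⟨i, j⟩ - hne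
    fin_cases i <;> fin_cases j <;> first | assumption | exact absurd rfl hne
  rintro ⟨i, j⟩
  fin_cases i <;> fin_cases j <;> assumption

theorem asymIndex_grid_three_two_le :
    ((pathGraph 3).boxProd (pathGraph 2)).asymIndex ≤ 1 := by
  refine asymIndex_le_one isAsymmetric_gridThreeTwoDiagonal (0, 0) (1, 1) ?_
  intro u v huv
  rw [boxProd_adj, pathGraph_adj, pathGraph_adj]
  revert u v
  decide

/-- Away from the `3 × 2` case, removing the edge from the corner `(0, 0)` to `(1, 0)` makes the
grid asymmetric. -/
theorem asymIndex_grid_le {r s : ℕ} (hr : 3 ≤ r) (hs : 2 ≤ s) (hrs : 4 ≤ r ∨ 3 ≤ s) :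
    ((pathGraph r).boxProd (pathGraph s)).asymIndex ≤ 1 := by
  let a : Fin r × Fin s := (⟨0, by omega⟩, ⟨0, by omega⟩)
  let b : Fin r × Fin s := (⟨1, by omega⟩, ⟨0, by omega⟩)
  let G' : SimpleGraph (Fin r × Fin s) :=
    ((pathGraph r).boxProd (pathGraph s)).deleteEdges {s(a, b)}
  refine asymIndex_le_one (G' := G') ?_ a b fun u v huv => by simp [G', deleteEdges_adj, huv]
  have hadj : ∀ (i j k l : ℕ) (hi : i < r) (hj : j < s) (hk : k < r) (hl : l < s),
      G'.Adj (⟨i, hi⟩, ⟨j, hj⟩) (⟨k, hk⟩, ⟨l, hl⟩) ↔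
        ((i + 1 = k ∨ k + 1 = i) ∧ j = l ∨ (j + 1 = l ∨ l + 1 = j) ∧ i = k) ∧
        ¬ (j = 0 ∧ l = 0 ∧ i + k = 1) := by
    intro i j k l hi hj hk hl
    simp only [G', a, b, deleteEdges_adj, boxProd_adj, pathGraph_adj, Set.mem_singleton_iff,
      Sym2.eq_iff, Prod.ext_iff, Fin.ext_iff]
    omega
  have hext : ∀ (i j k l : ℕ) (hi : i < r) (hj : j < s) (hk : k < r) (hl : l < s),
      ((⟨i, hi⟩, ⟨j, hj⟩) : Fin r × Fin s) = (⟨k, hk⟩, ⟨l, hl⟩) ↔ i = k ∧ j = l := by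
    simp
  clear_value G'
  intro f
  have hinj := f.injective
  let P (i j : ℕ) : Prop := ∀ (hi : i < r) (hj : j < s),
    f (⟨i, hi⟩, ⟨j, hj⟩) = (⟨i, hi⟩, ⟨j, hj⟩)
  have hpull : ∀ x y, G'.Adj (f x) y → G'.Adj x (f.symm y) := by
    intro x y h
    rw [← f.map_adj_iff]
    simpa using h
  have h00 : P 0 0 := by
    intro hi hj
    refine fixed_of_invariant hinj (fun x => ∀ y z, G'.Adj x y → G'.Adj x z → y = z) ?_ _ ?_ ?_
    · intro x hx y z hy hz
      exact f.symm.injective (hx _ _ (hpull x y hy) (hpull x z hz))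
    · rintro ⟨⟨i, hi⟩, ⟨j, hj⟩⟩ ⟨⟨k, hk⟩, ⟨l, hl⟩⟩ hy hz
      simp only [hadj, hext, true_and] at hy hz ⊢
      omega
    · rintro ⟨⟨i, hi⟩, ⟨j, hj⟩⟩ hx hne
      exfalso
      have key := fun k l k' l' hk hl hk' hl' => hx (⟨k, hk⟩, ⟨l, hl⟩) (⟨k', hk'⟩, ⟨l', hl'⟩)
      simp only [hadj, hext, ne_eq] at key hne
      have h1 := key (i + 1) j (i - 1) j
      have h2 := key i (j + 1) i (j - 1)
      have h3 := key (i + 1) j i (j + 1)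
      have h4 := key (i + 1) j i (j - 1)
      have h5 := key (i - 1) j i (j + 1)
      have h6 := key (i - 1) j i (j - 1)
      omega
  have h01 : P 0 1 := by
    intro hi hj
    refine fixed_of_invariant hinj _ (f.adj_apply_of_fixed (h00 hi (by omega))) _
      ((hadj ..).2 (by omega)) ?_
    rintro ⟨⟨i, hi⟩, ⟨j, hj⟩⟩ hx hne
    simp only [hadj, hext, ne_eq, true_and] at hx hne
    omega
  have h11 : P 1 1 := by
    intro hi hj
    obtain rfl | hs3 : s = 2 ∨ 3 ≤ s := by omega
    · refine fixed_of_invariant hinj _ (f.adj_apply_of_fixed (h01 (by omega) hj)) _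
        ((hadj ..).2 (by omega)) ?_
      rintro ⟨⟨i, hi⟩, ⟨j, hj⟩⟩ hx hne
      simp only [hadj, hext, ne_eq] at hx hne
      obtain ⟨rfl, rfl⟩ : i = 0 ∧ j = 0 := by omega
      exact h00 _ _
    · refine fixed_of_invariant hinj
        (fun x => G'.Adj (⟨0, by omega⟩, ⟨1, hj⟩) x ∧ ∃ u v w,
          G'.Adj x u ∧ G'.Adj x v ∧ G'.Adj x w ∧ u ≠ v ∧ v ≠ w ∧ u ≠ w ∧
          u ≠ (⟨0, by omega⟩, ⟨1, hj⟩) ∧ v ≠ (⟨0, by omega⟩, ⟨1, hj⟩) ∧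
          w ≠ (⟨0, by omega⟩, ⟨1, hj⟩)) ?_ _ ?_ ?_
      · have hfix := h01 (by omega) hj
        rintro x ⟨hx, u, v, w, hu, hv, hw, huv, hvw, huw, hu', hv', hw'⟩
        refine ⟨f.adj_apply_of_fixed hfix x hx, f u, f v, f w, f.map_adj_iff.2 hu,
          f.map_adj_iff.2 hv, f.map_adj_iff.2 hw, hinj.ne huv, hinj.ne hvw, hinj.ne huw, ?_, ?_, ?_⟩
        all_goals rw [← hfix]; exact hinj.ne ‹_›
      · refine ⟨(hadj ..).2 (by omega), (⟨1, by omega⟩, ⟨0, by omega⟩),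
          (⟨2, by omega⟩, ⟨1, by omega⟩), (⟨1, by omega⟩, ⟨2, by omega⟩), ?_⟩
        simp [hadj, hext]
      · rintro ⟨⟨i, hi⟩, ⟨j, hj⟩⟩ ⟨hx, u, v, w, hu, hv, hw, huv, hvw, huw, hu', hv', hw'⟩ hne
        simp only [hadj, hext, ne_eq] at hx hne
        obtain ⟨rfl, rfl⟩ | ⟨rfl, rfl⟩ : i = 0 ∧ j = 0 ∨ i = 0 ∧ j = 2 := by omega
        · exact h00 _ _
        · have hnbr : ∀ x, G'.Adj (⟨0, hi⟩, ⟨2, hj⟩) x → x ≠ (⟨0, hi⟩, ⟨1, by omega⟩) →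
              x.1.val + x.2.val = 3 ∧ x.1.val ≤ 1 := by
            rintro ⟨⟨k, hk⟩, ⟨l, hl⟩⟩ hx hne
            simp only [hadj, hext, ne_eq] at hx hne ⊢
            omega
          have := hnbr u hu hu'
          have := hnbr v hv hv'
          have := hnbr w hw hw'
          simp only [ne_eq, Prod.ext_iff, Fin.ext_iff] at huv hvw huw
          omega
  have hcol : ∀ j, P 0 j ∧ P 0 (j + 1) ∧ P 1 (j + 1) := by
    intro j
    induction j with
    | zero => exact ⟨h00, h01, h11⟩
    | succ j ih =>
      obtain ⟨ha, hb, hc⟩ := ih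
      have hd : P 0 (j + 1 + 1) := by
        intro hi hj
        refine fixed_of_invariant hinj _ (f.adj_apply_of_fixed (hb hi (by omega))) _
          ((hadj ..).2 (by omega)) ?_
        rintro ⟨⟨k, hk⟩, ⟨l, hl⟩⟩ hx hne
        simp only [hadj, hext, ne_eq] at hx hne
        obtain ⟨rfl, rfl⟩ | ⟨rfl, rfl⟩ : k = 0 ∧ l = j ∨ k = 1 ∧ l = j + 1 := by omega
        · exact ha _ _
        · exact hc _ _
      refine ⟨hb, hd, fun hi hj => ?_⟩
      refine fixed_of_invariant hinj _
        (fun x (hx : _ ∧ _) => ⟨f.adj_apply_of_fixed (hd (by omega) hj) x hx.1,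
          f.adj_apply_of_fixed (hc hi (by omega)) x hx.2⟩) _
        ⟨(hadj ..).2 (by omega), (hadj ..).2 (by omega)⟩ ?_
      rintro ⟨⟨k, hk⟩, ⟨l, hl⟩⟩ hx hne
      simp only [hadj, hext, ne_eq] at hx hne
      obtain ⟨rfl, rfl⟩ : k = 0 ∧ l = j + 1 := by omega
      exact hb _ _
  have h10 : P 1 0 := by
    intro hi hj
    refine fixed_of_invariant hinj (fun x => G'.Adj (⟨1, hi⟩, ⟨1, by omega⟩) x ∧
      ∀ u v w, G'.Adj x u → G'.Adj x v → G'.Adj x w → u = v ∨ v = w ∨ u = w) ?_ _ ?_ ?_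
    · rintro x ⟨hx, h⟩
      refine ⟨f.adj_apply_of_fixed (h11 _ _) x hx, fun u v w hu hv hw => ?_⟩
      simpa using h _ _ _ (hpull _ _ hu) (hpull _ _ hv) (hpull _ _ hw)
    · refine ⟨(hadj ..).2 (by omega), ?_⟩
      rintro ⟨⟨u, hu⟩, ⟨u', hu'⟩⟩ ⟨⟨v, hv⟩, ⟨v', hv'⟩⟩ ⟨⟨w, hw⟩, ⟨w', hw'⟩⟩
      simp only [hadj, hext, true_and]
      omega
    · rintro ⟨⟨i, hi⟩, ⟨j, hj⟩⟩ ⟨hx, h⟩ hne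
      simp only [hadj, hext, ne_eq] at hx hne
      obtain ⟨rfl, rfl⟩ | ⟨rfl, rfl⟩ | ⟨rfl, rfl⟩ :
        i = 0 ∧ j = 1 ∨ i = 1 ∧ j = 2 ∨ i = 2 ∧ j = 1 := by omega
      · exact h01 _ _
      · exact (hcol 1).2.2 _ _
      · exfalso
        have hcard : ∀ k l (hk : k < r) (hl : l < s), k + l = 4 → 2 ≤ k → k ≤ 3 → False := by
          intro k l hk hl hkl hk2 hk3
          have := h (⟨1, by omega⟩, ⟨1, by omega⟩) (⟨2, by omega⟩, ⟨0, by omega⟩)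
            (⟨k, hk⟩, ⟨l, hl⟩) ((hadj ..).2 (by omega)) ((hadj ..).2 (by omega))
            ((hadj ..).2 (by omega))
          simp only [hext] at this
          omega
        obtain hr4 | hs3 := hrs
        · exact hcard 3 1 (by omega) (by omega) (by omega) (by omega) (by omega)
        · exact hcard 2 2 (by omega) (by omega) (by omega) (by omega) (by omega)
  have hrow : ∀ i, (∀ j, P i j) ∧ ∀ j, P (i + 1) j := by
    intro i
    induction i with
    | zero =>
      refine ⟨fun j => (hcol j).1, fun j => ?_⟩
      cases j with
      | zero => exact h10
      | succ j => exact (hcol j).2.2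
    | succ i ih =>
      obtain ⟨ha, hb⟩ := ih
      refine ⟨hb, fun j hi hj => ?_⟩
      refine fixed_of_invariant hinj _ (f.adj_apply_of_fixed (hb j (by omega) hj)) _
        ((hadj ..).2 (by omega)) ?_
      rintro ⟨⟨k, hk⟩, ⟨l, hl⟩⟩ hx hne
      simp only [hadj, hext, ne_eq] at hx hne
      obtain rfl | rfl : k = i ∨ k = i + 1 := by omega
      · exact ha _ _ _
      · exact hb _ _ _
  exact fun v => (hrow v.1).1 v.2 v.1.2 v.2.2

end SimpleGraph

/-- For `r, s ≥ 2` with `r·s ≥ 6`, the grid graph `P_r □ P_s` has asymmetric index 1. -/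
theorem asymIndex_grid {r s : ℕ} (hr : 2 ≤ r) (hs : 2 ≤ s) (hrs : 6 ≤ r * s) :
    ((SimpleGraph.pathGraph r).boxProd (SimpleGraph.pathGraph s)).asymIndex = 1 := by
  refine le_antisymm ?_ (SimpleGraph.one_le_asymIndex (SimpleGraph.not_isAsymmetric_grid hr hs))
  have main : ∀ r s : ℕ, 3 ≤ r → 2 ≤ s →
      ((SimpleGraph.pathGraph r).boxProd (SimpleGraph.pathGraph s)).asymIndex ≤ 1 := by
    intro r s hr hs
    by_cases h : 4 ≤ r ∨ 3 ≤ s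
    · exact SimpleGraph.asymIndex_grid_le hr hs h
    · obtain ⟨rfl, rfl⟩ : r = 3 ∧ s = 2 := by omega
      exact SimpleGraph.asymIndex_grid_three_two_le
  obtain rfl | hr3 : r = 2 ∨ 3 ≤ r := by omega
  · exact (SimpleGraph.boxProdComm _ _).asymIndex_le.trans (main s 2 (by omega) le_rfl)
  · exact main r s hr3 hs
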